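/- arXiv:1308.0410 — 9 statements merged into one kernel-verified Lean document; each statement's English description precedes it below -/
import Mathlib

section
/- Fix n ≥ 1 and multi-indices α, β ∈ ℕⁿ. Let V be a finite set equipped with a coloring c : V → {1,…,n} and a sign function ε : V → {+1,−1} such that for each j there are exactly α_j elements of color j with sign +1 and exactly β_j elements of color j with sign −1. Then the sum, over all perfect matchings M of V in which both endpoints of every pair have the same color, of the product over pairs {u,v} ∈ M of (−ε(u)·ε(v)), equals A(α,β). (In particular the sum is 0 when some α_j + β_j is odd, since then no such matching exists.) -/
open Finset
open scoped Classical

/-- The constant `A(α,β)` of Definition 1: if every `α_j + β_j` is even, with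
`σ_j = (α_j + β_j)/2`, it is `(−1)^{(|α|−|β|)/2} · Π_j (2σ_j)! / (2^{σ_j} σ_j!)`;
if some `α_j + β_j` is odd it is `0`. -/
noncomputable def Acoef (n : ℕ) (α β : Fin n → ℕ) : ℝ :=
  if ∀ j, Even (α j + β j) then
    (-1 : ℝ) ^ (((∑ j, (α j : ℤ)) - ∑ j, (β j : ℤ)) / 2) *
      ∏ j, ((α j + β j).factorial : ℝ) /
        (2 ^ ((α j + β j) / 2) * (((α j + β j) / 2).factorial : ℝ))
  else 0

/-- A perfect matching of a finite set `V`: a collection of two-element subsets such that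
every element of `V` belongs to exactly one of them (i.e. a partition of `V` into pairs). -/
def IsPerfectMatching (V : Type*) [Fintype V] [DecidableEq V] (M : Finset (Finset V)) : Prop :=
  (∀ p ∈ M, p.card = 2) ∧ ∀ v : V, ∃! p, p ∈ M ∧ v ∈ p

def gcount : ℕ → ℕ
  | 0 => 1
  | 1 => 0
  | m + 2 => (m + 1) * gcount m

lemma gcount_odd (k : ℕ) : gcount (2 * k + 1) = 0 := by
  induction k with
  | zero => rfl
  | succ k ih =>
    have : 2 * (k + 1) + 1 = (2 * k + 1) + 2 := by ring
    rw [this, gcount, ih, mul_zero]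

lemma gcount_even (k : ℕ) : gcount (2 * k) * (2 ^ k * k.factorial) = (2 * k).factorial := by
  induction k with
  | zero => rfl
  | succ k ih =>
    have : 2 * (k + 1) = (2 * k) + 2 := by ring
    rw [this, gcount, Nat.factorial_succ, Nat.factorial_succ, Nat.factorial_succ, ← ih]
    ring

noncomputable def Mt {V : Type*} [Fintype V] {n : ℕ} (c : V → Fin n) (S : Finset V) :
    Finset (Finset (Finset V)) :=
  Finset.univ.filter fun M => (∀ p ∈ M, p.card = 2 ∧ p ⊆ S ∧ ∀ u ∈ p, ∀ v ∈ p, c u = c v) ∧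
    ∀ v ∈ S, ∃! p, p ∈ M ∧ v ∈ p

lemma mem_Mt {V : Type*} [Fintype V] {n : ℕ} (c : V → Fin n) (S : Finset V)
    (M : Finset (Finset V)) : M ∈ Mt c S ↔
    (∀ p ∈ M, p.card = 2 ∧ p ⊆ S ∧ ∀ u ∈ p, ∀ v ∈ p, c u = c v) ∧
    ∀ v ∈ S, ∃! p, p ∈ M ∧ v ∈ p := by
  simp [Mt]

lemma Mt_insert {V : Type*} [Fintype V] {n : ℕ} (c : V → Fin n) (S : Finset V)
    (v u : V) (hv : v ∈ S) (hu : u ∈ S) (huv : u ≠ v) (hc : c u = c v)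
    (M : Finset (Finset V)) (hM : M ∈ Mt c (S \ {v, u})) :
    insert {v, u} M ∈ Mt c S := by
  rw [mem_Mt] at hM ⊢
  obtain ⟨h1, h2⟩ := hM
  constructor
  · intro p hp
    rcases Finset.mem_insert.1 hp with rfl | hp
    · refine ⟨Finset.card_pair huv.symm, ?_, ?_⟩
      · intro x hx; simp at hx; rcases hx with rfl | rfl <;> assumption
      · intro x hx y hy; simp at hx hy
        rcases hx with rfl | rfl <;> rcases hy with rfl | rfl <;> simp [hc]
    · obtain ⟨a, b, d⟩ := h1 p hp
      exact ⟨a, b.trans Finset.sdiff_subset, d⟩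
  · intro w hw
    by_cases hwe : w ∈ ({v, u} : Finset V)
    · refine ⟨{v, u}, ⟨Finset.mem_insert_self _ _, hwe⟩, ?_⟩
      rintro q ⟨hq, hwq⟩
      rcases Finset.mem_insert.1 hq with rfl | hq
      · rfl
      · have := (h1 q hq).2.1 hwq
        exact absurd hwe (Finset.mem_sdiff.1 this).2
    · obtain ⟨p, ⟨hp, hwp⟩, huniq⟩ := h2 w (Finset.mem_sdiff.2 ⟨hw, hwe⟩)
      refine ⟨p, ⟨Finset.mem_insert_of_mem hp, hwp⟩, ?_⟩
      rintro q ⟨hq, hwq⟩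
      rcases Finset.mem_insert.1 hq with rfl | hq
      · exact absurd hwq hwe
      · exact huniq q ⟨hq, hwq⟩

lemma Mt_erase {V : Type*} [Fintype V] {n : ℕ} (c : V → Fin n) (S : Finset V)
    (v : V) (hv : v ∈ S) (M : Finset (Finset V)) (hM : M ∈ Mt c S) :
    ∃ u, u ∈ S ∧ u ≠ v ∧ c u = c v ∧ ∃ M' ∈ Mt c (S \ {v, u}), insert {v, u} M' = M := by
  rw [mem_Mt] at hM
  obtain ⟨h1, h2⟩ := hM
  obtain ⟨p, ⟨hp, hvp⟩, -⟩ := h2 v hv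
  obtain ⟨hcard, hsub, hmono⟩ := h1 p hp
  obtain ⟨u, huv, rfl⟩ : ∃ u, u ≠ v ∧ p = {v, u} := by
    obtain ⟨x, y, hxy, rfl⟩ := Finset.card_eq_two.1 hcard
    simp at hvp
    rcases hvp with rfl | rfl
    · exact ⟨y, hxy.symm, rfl⟩
    · exact ⟨x, hxy, Finset.pair_comm _ _⟩
  have hu : u ∈ S := hsub (by simp)
  refine ⟨u, hu, huv, hmono _ (by simp) _ (by simp), M.erase {v, u}, ?_,
    Finset.insert_erase hp⟩
  rw [mem_Mt]
  constructor
  · intro q hq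
    obtain ⟨hne, hq⟩ := Finset.mem_erase.1 hq
    obtain ⟨a, b, d⟩ := h1 q hq
    refine ⟨a, ?_, d⟩
    intro x hx
    refine Finset.mem_sdiff.2 ⟨b hx, fun hxe => hne ?_⟩
    exact (h2 x (b hx)).unique ⟨hq, hx⟩ ⟨hp, hxe⟩
  · intro w hw
    obtain ⟨hw, hwe⟩ := Finset.mem_sdiff.1 hw
    obtain ⟨q, ⟨hq, hwq⟩, huniq⟩ := h2 w hw
    refine ⟨q, ⟨Finset.mem_erase.2 ⟨?_, hq⟩, hwq⟩, ?_⟩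
    · rintro rfl; exact hwe hwq
    · rintro r ⟨hr, hwr⟩
      exact huniq r ⟨Finset.mem_of_mem_erase hr, hwr⟩

lemma Mt_rec {V : Type*} [Fintype V] {n : ℕ} (c : V → Fin n) (S : Finset V)
    (v : V) (hv : v ∈ S) :
    (Mt c S).card = ∑ u ∈ (S.filter fun u => c u = c v).erase v, (Mt c (S \ {v, u})).card := by
  have key : Mt c S = ((S.filter fun u => c u = c v).erase v).biUnion
      fun u => (Mt c (S \ {v, u})).image fun M => insert {v, u} M := by
    ext M
    simp only [Finset.mem_biUnion, Finset.mem_image, Finset.mem_erase, Finset.mem_filter]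
    constructor
    · intro hM
      obtain ⟨u, hu, huv, hc, M', hM', h⟩ := Mt_erase c S v hv M hM
      exact ⟨u, ⟨huv, hu, hc⟩, M', hM', h⟩
    · rintro ⟨u, ⟨huv, hu, hc⟩, M', hM', rfl⟩
      exact Mt_insert c S v u hv hu huv hc M' hM'
  rw [key, Finset.card_biUnion]
  · refine Finset.sum_congr rfl fun u hu => ?_
    have hnot : ∀ M ∈ Mt c (S \ {v, u}), ({v, u} : Finset V) ∉ M := by
      intro M hM hmem
      have := (((mem_Mt _ _ _).1 hM).1 _ hmem).2.1 (Finset.mem_insert_self v {u})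
      simp at this
    refine Finset.card_image_of_injOn ?_
    intro M1 h1 M2 h2 h
    have h := congrArg (fun M => Finset.erase M {v, u}) h
    simpa [Finset.erase_insert (hnot M1 h1), Finset.erase_insert (hnot M2 h2)] using h
  · intro u hu u' hu' hne
    refine Finset.disjoint_left.2 ?_
    intro M hM hM'
    obtain ⟨M1, h1, rfl⟩ := Finset.mem_image.1 hM
    obtain ⟨M2, h2, h⟩ := Finset.mem_image.1 hM'
    simp only [Finset.mem_erase, Finset.mem_filter, Finset.mem_coe] at hu hu'
    have hin := Mt_insert c S v u hv hu.2.1 hu.1 hu.2.2 M1 h1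
    have hE := (((mem_Mt _ _ _).1 hin).2 v hv).unique
      (y₁ := {v, u}) (y₂ := {v, u'}) ⟨by simp, by simp⟩ ⟨by simp [← h], by simp⟩
    have : u ∈ ({v, u'} : Finset V) := hE ▸ (by simp)
    simp at this
    rcases this with h | h
    · exact hu.1 h
    · exact hne h

lemma Mt_card {V : Type*} [Fintype V] {n : ℕ} (c : V → Fin n) (k : ℕ) :
    ∀ S : Finset V, S.card = k →
      (Mt c S).card = ∏ j, gcount (S.filter fun u => c u = j).card := by
  induction k using Nat.strong_induction_on with
  | _ k ih =>
  intro S hS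
  rcases S.eq_empty_or_nonempty with rfl | ⟨v, hv⟩
  · have : Mt c (∅ : Finset V) = {∅} := by
      ext M
      rw [mem_Mt, Finset.mem_singleton]
      constructor
      · rintro ⟨h, -⟩
        refine Finset.eq_empty_of_forall_notMem fun p hp => ?_
        obtain ⟨a, b, -⟩ := h p hp
        rw [Finset.subset_empty.1 b] at a
        simp at a
      · rintro rfl; simp
    simp [this, gcount]
  · rw [Mt_rec c S v hv]
    have hterm : ∀ u ∈ (S.filter fun u => c u = c v).erase v,
        (Mt c (S \ {v, u})).card = gcount ((S.filter fun u => c u = c v).card - 2) *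
          ∏ j ∈ Finset.univ.erase (c v), gcount (S.filter fun u => c u = j).card := by
      intro u hu
      simp only [Finset.mem_erase, Finset.mem_filter] at hu
      obtain ⟨huv, hu, hc⟩ := hu
      have hsub : ({v, u} : Finset V) ⊆ S := by
        intro x hx; simp at hx; rcases hx with rfl | rfl <;> assumption
      have hcard : (S \ {v, u}).card < k := by
        rw [← hS]
        exact Finset.card_lt_card (Finset.ssubset_iff_subset_ne.2
          ⟨Finset.sdiff_subset, fun h => by rw [← h] at hv; simp at hv⟩)
      rw [ih _ hcard _ rfl, ← Finset.mul_prod_erase _ _ (Finset.mem_univ (c v))]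
      congr 1
      · congr 1
        have : (S \ {v, u}).filter (fun x => c x = c v) =
            (S.filter fun x => c x = c v) \ {v, u} := by
          ext x; simp; tauto
        rw [this, Finset.card_sdiff_of_subset, Finset.card_pair huv.symm]
        intro x hx; simp at hx; rcases hx with rfl | rfl <;> simp [*]
      · refine Finset.prod_congr rfl fun j hj => ?_
        have hj := Finset.ne_of_mem_erase hj
        congr 2
        ext x
        simp only [Finset.mem_filter, Finset.mem_sdiff, Finset.mem_insert, Finset.mem_singleton]
        constructor
        · tauto
        · rintro ⟨a, b⟩
          refine ⟨⟨a, ?_⟩, b⟩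
          rintro (rfl | rfl)
          · exact hj b.symm
          · exact hj (b.symm.trans hc)
    have hvm : v ∈ S.filter fun u => c u = c v := by simp [hv]
    rw [Finset.sum_congr rfl hterm, Finset.sum_const, Finset.card_erase_of_mem hvm, smul_eq_mul,
      ← Finset.mul_prod_erase Finset.univ _ (Finset.mem_univ (c v)), ← mul_assoc]
    congr 1
    have hpos := Finset.card_pos.2 ⟨v, hvm⟩
    generalize (S.filter fun u => c u = c v).card = m at hpos
    match m, hpos with
    | 1, _ => simp [gcount]
    | m + 2, _ => simp [gcount]

lemma Mt_weight {V : Type*} [Fintype V] {n : ℕ} (c : V → Fin n) (ε : V → ℝ)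
    (M : Finset (Finset V)) (hM : M ∈ Mt c Finset.univ) :
    ∏ p ∈ M, -(∏ x ∈ p, ε x) = (-1) ^ (Fintype.card V / 2) * ∏ x, ε x := by
  obtain ⟨h1, h2⟩ := (mem_Mt _ _ _).1 hM
  have hU : (Finset.univ : Finset V) = M.biUnion id := by
    ext x
    obtain ⟨p, hp, -⟩ := h2 x (Finset.mem_univ x)
    simp only [Finset.mem_univ, Finset.mem_biUnion, id, true_iff]
    exact ⟨p, hp⟩
  have hd : (M : Set (Finset V)).PairwiseDisjoint id := by
    intro p hp q hq hne
    refine Finset.disjoint_left.2 fun x hx hx' => hne ?_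
    exact (h2 x (Finset.mem_univ x)).unique ⟨hp, hx⟩ ⟨hq, hx'⟩
  have hc : Fintype.card V = M.card * 2 := by
    rw [← Finset.card_univ, hU, Finset.card_biUnion hd]
    exact Finset.sum_const_nat fun p hp => (h1 p hp).1
  rw [Finset.prod_neg, hc, Nat.mul_div_cancel _ (by norm_num), hU, Finset.prod_biUnion hd]
  rfl

/-- **Signed count of admissible graphs equals `A(α,β)`.** If `V` carries a coloring
`c : V → {1,…,n}` and a sign `ε : V → {±1}` with exactly `α_j` elements of color `j` and sign
`+1`, and exactly `β_j` elements of color `j` and sign `−1`, then the sum over all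
monochromatic perfect matchings `M` of `V` of `Π_{{u,v} ∈ M} (−ε(u)·ε(v))` equals `A(α,β)`. -/
theorem signed_count_admissible_graphs (n : ℕ) (hn : 1 ≤ n) (α β : Fin n → ℕ)
    (V : Type*) [Fintype V] [DecidableEq V] (c : V → Fin n) (ε : V → ℝ)
    (hε : ∀ v, ε v = 1 ∨ ε v = -1)
    (hα : ∀ j, (Finset.univ.filter fun v => c v = j ∧ ε v = 1).card = α j)
    (hβ : ∀ j, (Finset.univ.filter fun v => c v = j ∧ ε v = -1).card = β j) :
    (∑ M ∈ Finset.univ.filter (fun M : Finset (Finset V) =>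
          IsPerfectMatching V M ∧ ∀ p ∈ M, ∀ u ∈ p, ∀ v ∈ p, c u = c v),
        ∏ p ∈ M, -(∏ x ∈ p, ε x))
      = Acoef n α β := by
  have hset : (Finset.univ.filter (fun M : Finset (Finset V) =>
      IsPerfectMatching V M ∧ ∀ p ∈ M, ∀ u ∈ p, ∀ v ∈ p, c u = c v)) = Mt c Finset.univ := by
    ext M
    rw [mem_Mt, Finset.mem_filter]
    simp only [Finset.mem_univ, true_and, IsPerfectMatching,
      Finset.subset_univ, forall_true_left]
    constructor
    · rintro ⟨⟨a, b⟩, d⟩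
      exact ⟨fun p hp => ⟨a p hp, d p hp⟩, b⟩
    · rintro ⟨a, b⟩
      exact ⟨⟨fun p hp => (a p hp).1, b⟩, fun p hp => (a p hp).2⟩
  rw [hset, Finset.sum_congr rfl fun M hM => Mt_weight c ε M hM, Finset.sum_const,
    Mt_card c _ _ rfl, nsmul_eq_mul]
  have hcol : ∀ j, (Finset.univ.filter fun v => c v = j).card = α j + β j := by
    intro j
    rw [← hα, ← hβ, ← Finset.card_union_of_disjoint]
    · congr 1
      ext x
      have := hε x
      simp only [Finset.mem_filter, Finset.mem_univ, true_and, Finset.mem_union]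
      tauto
    · rw [Finset.disjoint_left]
      intro x hx hx'
      have h1 := (Finset.mem_filter.1 hx).2.2
      have h2 := (Finset.mem_filter.1 hx').2.2
      rw [h1] at h2
      norm_num at h2
  simp only [hcol]
  unfold Acoef
  split_ifs with hev
  · have hV : Fintype.card V = ∑ j, (α j + β j) := by
      rw [← Finset.card_univ, Finset.card_eq_sum_card_fiberwise (f := c) (t := Finset.univ)
        (by simp)]
      exact Finset.sum_congr rfl fun j _ => hcol j
    have hprod : ∏ x, ε x = (-1) ^ (∑ j, β j) := by
      have h1 : ∀ x, ε x = if ε x = -1 then (-1 : ℝ) else 1 := by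
        intro x
        rcases hε x with h | h <;> rw [h] <;> norm_num
      rw [Finset.prod_congr rfl fun x _ => h1 x, Finset.prod_ite, Finset.prod_const,
        Finset.prod_const_one, mul_one]
      congr 1
      rw [Finset.card_eq_sum_card_fiberwise (f := c) (t := Finset.univ) (by simp)]
      refine Finset.sum_congr rfl fun j _ => ?_
      rw [← hβ, Finset.filter_filter]
      congr 1
      ext x
      simp [and_comm]
    rw [hprod, hV, mul_comm]
    congr 1
    · have he : Even (∑ j, (α j + β j)) := Finset.even_sum _ fun j _ => hev j
      rw [Finset.sum_add_distrib] at he ⊢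
      rw [← Nat.cast_sum, ← Nat.cast_sum]
      generalize ∑ j, α j = a at he ⊢
      generalize ∑ j, β j = b at he ⊢
      obtain ⟨k, hk⟩ := he
      have e1 : (a + b) / 2 = k := by omega
      have e2 : ((a : ℤ) - b) / 2 = (k : ℤ) - b := by omega
      rw [e1, e2, zpow_sub₀ (by norm_num), zpow_natCast, zpow_natCast, div_eq_mul_inv,
        ← inv_pow]
      norm_num
    · rw [Nat.cast_prod]
      refine Finset.prod_congr rfl fun j _ => ?_
      obtain ⟨k, hk⟩ := hev j
      have hk : α j + β j = 2 * k := by omega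
      rw [hk, Nat.mul_div_cancel_left _ (by norm_num), eq_div_iff (by positivity)]
      exact_mod_cast gcount_even k
  · push Not at hev
    obtain ⟨j, hj⟩ := hev
    obtain ⟨k, hk⟩ := Nat.not_even_iff_odd.1 hj
    rw [Finset.prod_eq_zero (Finset.mem_univ j) (by rw [hk, gcount_odd])]
    simp
end

section
/- Let a ≤ b be natural numbers with a + b even, and set σ = (a+b)/2 and l = (b−a)/2. Then, as an identity of rational numbers, ((2σ)!/σ!)² · (a! · b!) / ((2a)! · (2b)!) = Π_{i=1}^{l} (2σ − 2i + 1)/(2σ + 2i − 1). In particular this quantity is at most 1. -/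
open Finset

lemma f_succ (n : ℕ) : (((2 * (n + 1)).factorial : ℚ) / ((n + 1).factorial : ℚ))
    = 2 * (2 * n + 1) * (((2 * n).factorial : ℚ) / (n.factorial : ℚ)) := by
  have h : 2 * (n + 1) = (2 * n + 1) + 1 := by ring
  have h1 : (n.factorial : ℚ) ≠ 0 := by positivity
  have h2 : (n : ℚ) + 1 ≠ 0 := by positivity
  rw [h, Nat.factorial_succ, Nat.factorial_succ, Nat.factorial_succ]
  push_cast
  field_simp
  ring

lemma f_main (l : ℕ) : ∀ a : ℕ,
    (((2 * (a + l)).factorial : ℚ) / ((a + l).factorial : ℚ)) ^ 2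
      = (∏ i ∈ Finset.Icc 1 l, (2 * ((a + l : ℕ) : ℚ) - 2 * (i : ℚ) + 1) /
          (2 * ((a + l : ℕ) : ℚ) + 2 * (i : ℚ) - 1)) *
        ((((2 * a).factorial : ℚ) / (a.factorial : ℚ)) *
        (((2 * (a + 2 * l)).factorial : ℚ) / ((a + 2 * l).factorial : ℚ))) := by
  induction l with
  | zero => intro a; simp [sq]
  | succ l ih =>
    intro a
    have h := ih (a + 1)
    rw [show a + 1 + l = a + (l + 1) by ring] at h
    rw [h, Finset.prod_Icc_succ_top (by omega), f_succ a,
      show a + 2 * (l + 1) = (a + 1 + 2 * l) + 1 by ring, f_succ (a + 1 + 2 * l)]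
    generalize (∏ i ∈ Finset.Icc 1 l, (2 * ((a + (l + 1) : ℕ) : ℚ) - 2 * (i : ℚ) + 1) /
          (2 * ((a + (l + 1) : ℕ) : ℚ) + 2 * (i : ℚ) - 1)) = P
    generalize (((2 * a).factorial : ℚ) / (a.factorial : ℚ)) = x
    generalize (((2 * (a + 1 + 2 * l)).factorial : ℚ) / ((a + 1 + 2 * l).factorial : ℚ)) = y
    push_cast
    have e1 : 2 * ((a : ℚ) + (l + 1)) - 2 * (l + 1) + 1 = 2 * a + 1 := by ring
    have e2 : 2 * ((a : ℚ) + (l + 1)) + 2 * (l + 1) - 1 = 2 * (a + 1 + 2 * l) + 1 := by ring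
    rw [e1, e2]
    have h3 : 2 * ((a : ℚ) + 1 + 2 * l) + 1 ≠ 0 := by positivity
    field_simp

/-- **A factorial-ratio identity.** If `a ≤ b`, `a + b = 2σ` and `b − a = 2l`, then
`((2σ)!/σ!)² · a!·b! / ((2a)!·(2b)!) = Π_{i=1}^{l} (2σ−2i+1)/(2σ+2i−1)`, as rational numbers,
and in particular this quantity is at most `1`. -/
theorem factorial_ratio_identity (a b σ l : ℕ) (hab : a ≤ b)
    (hσ : a + b = 2 * σ) (hl : b = a + 2 * l) :
    ((((2 * σ).factorial : ℚ) / (σ.factorial : ℚ)) ^ 2 *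
        ((a.factorial : ℚ) * (b.factorial : ℚ)) /
        (((2 * a).factorial : ℚ) * ((2 * b).factorial : ℚ))
      = ∏ i ∈ Finset.Icc 1 l, (2 * (σ : ℚ) - 2 * (i : ℚ) + 1) / (2 * (σ : ℚ) + 2 * (i : ℚ) - 1))
    ∧ (((2 * σ).factorial : ℚ) / (σ.factorial : ℚ)) ^ 2 *
        ((a.factorial : ℚ) * (b.factorial : ℚ)) /
        (((2 * a).factorial : ℚ) * ((2 * b).factorial : ℚ)) ≤ 1 := by
  obtain rfl : σ = a + l := by omega
  subst hl
  have key : ((((2 * (a + l)).factorial : ℚ) / ((a + l).factorial : ℚ)) ^ 2 *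
        ((a.factorial : ℚ) * ((a + 2 * l).factorial : ℚ)) /
        (((2 * a).factorial : ℚ) * ((2 * (a + 2 * l)).factorial : ℚ))
      = ∏ i ∈ Finset.Icc 1 l, (2 * ((a + l : ℕ) : ℚ) - 2 * (i : ℚ) + 1) /
        (2 * ((a + l : ℕ) : ℚ) + 2 * (i : ℚ) - 1)) := by
    rw [f_main l a]
    have h1 : (a.factorial : ℚ) ≠ 0 := by positivity
    have h2 : ((a + 2 * l).factorial : ℚ) ≠ 0 := by positivity
    have h3 : ((2 * a).factorial : ℚ) ≠ 0 := by positivity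
    have h4 : ((2 * (a + 2 * l)).factorial : ℚ) ≠ 0 := by positivity
    generalize (∏ i ∈ Finset.Icc 1 l, (2 * ((a + l : ℕ) : ℚ) - 2 * (i : ℚ) + 1) /
        (2 * ((a + l : ℕ) : ℚ) + 2 * (i : ℚ) - 1)) = P
    field_simp
  refine ⟨key, ?_⟩
  rw [key]
  apply Finset.prod_le_one
  all_goals
    intro i hi
    rw [Finset.mem_Icc] at hi
    have hi1 : (1 : ℚ) ≤ i := by exact_mod_cast hi.1
    have hi2 : (i : ℚ) ≤ l := by exact_mod_cast hi.2
    have ha : (0 : ℚ) ≤ a := by positivity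
    push_cast
  · apply div_nonneg <;> linarith
  · rw [div_le_one (by linarith)]
    linarith
end

section
/- For all multi-indices α, β ∈ ℕⁿ and every index j ∈ {1,…,n}: B(α + e_j, β + e_j) = B(α,β) · (α_j + β_j + 1)/((2α_j+1)(2β_j+1))^{1/2}. Consequently B(α + e_j, β + e_j) and B(α,β) have the same sign, |B(α + e_j, β + e_j)| ≥ |B(α,β)|, and when B(α,β) ≠ 0 equality holds if and only if α_j = β_j. -/
open Finset

/-- The normalized constant `B(α,β) = A(α,β) / (A(α,α) · A(β,β))^{1/2}`. -/
noncomputable def Bcoef (n : ℕ) (α β : Fin n → ℕ) : ℝ :=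
  Acoef n α β / Real.sqrt (Acoef n α α * Acoef n β β)

/-- The angle distance `d(α,β) = arccos (B(α,β))` on the lattice `ℕⁿ`. -/
noncomputable def dAngle (n : ℕ) (α β : Fin n → ℕ) : ℝ :=
  Real.arccos (Bcoef n α β)

theorem Acoef_step (n : ℕ) (α β : Fin n → ℕ) (j : Fin n) :
    Acoef n (α + Pi.single j 1) (β + Pi.single j 1)
      = Acoef n α β * ((α j : ℝ) + (β j : ℝ) + 1) := by
  have hev : (∀ k, Even ((α + (Pi.single j 1 : Fin n → ℕ)) k + (β + (Pi.single j 1 : Fin n → ℕ)) k)) ↔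
      ∀ k, Even (α k + β k) := by
    refine forall_congr' fun k => ?_
    have : (α + (Pi.single j 1 : Fin n → ℕ)) k + (β + (Pi.single j 1 : Fin n → ℕ)) k
        = α k + β k + 2 * (Pi.single j 1 : Fin n → ℕ) k := by
      simp only [Pi.add_apply]; ring
    rw [this]
    simp [Nat.even_add]
  unfold Acoef
  by_cases h : ∀ k, Even (α k + β k)
  · rw [if_pos (hev.2 h), if_pos h]
    have hs : (∑ k, (((α + (Pi.single j 1 : Fin n → ℕ)) k : ℕ) : ℤ)) - ∑ k, (((β + (Pi.single j 1 : Fin n → ℕ)) k : ℕ) : ℤ)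
        = (∑ k, (α k : ℤ)) - ∑ k, (β k : ℤ) := by
      simp only [Pi.add_apply, Nat.cast_add, Finset.sum_add_distrib]; ring
    rw [hs, mul_assoc]
    congr 1
    rw [← Finset.mul_prod_erase _ _ (Finset.mem_univ j),
      ← Finset.mul_prod_erase (a := j) (s := Finset.univ)
        (fun k => ((α k + β k).factorial : ℝ) /
        (2 ^ ((α k + β k) / 2) * (((α k + β k) / 2).factorial : ℝ))) (Finset.mem_univ j)]
    rw [mul_right_comm]
    congr 1
    · obtain ⟨m, hm⟩ := h j
      have e1 : (α + (Pi.single j 1 : Fin n → ℕ)) j + (β + (Pi.single j 1 : Fin n → ℕ)) j = m + m + 1 + 1 := by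
        simp only [Pi.add_apply, Pi.single_eq_same]; omega
      have e2 : (m + m + 1 + 1) / 2 = m + 1 := by omega
      have e3 : (m + m) / 2 = m := by omega
      have e4 : (α j : ℝ) + (β j : ℝ) = m + m := by exact_mod_cast hm
      rw [e1, hm, e2, e3, e4]
      simp only [Nat.factorial_succ]
      push_cast
      have : (m.factorial : ℝ) ≠ 0 := by positivity
      field_simp
      ring
    · refine Finset.prod_congr rfl fun k hk => ?_
      have hk' : k ≠ j := Finset.ne_of_mem_erase hk
      simp [hk']
  · rw [if_neg (fun h' => h (hev.1 h')), if_neg h, zero_mul]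

theorem Bcoef_step (n : ℕ) (α β : Fin n → ℕ) (j : Fin n) :
    Bcoef n (α + Pi.single j 1) (β + Pi.single j 1)
        = Bcoef n α β * (((α j : ℝ) + (β j : ℝ) + 1) /
            Real.sqrt ((2 * (α j : ℝ) + 1) * (2 * (β j : ℝ) + 1))) := by
  unfold Bcoef
  simp only [Acoef_step]
  have : Acoef n α α * ((α j : ℝ) + α j + 1) * (Acoef n β β * ((β j : ℝ) + β j + 1))
      = ((2 * (α j : ℝ) + 1) * (2 * (β j : ℝ) + 1)) * (Acoef n α α * Acoef n β β) := by ring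
  rw [this, Real.sqrt_mul (by positivity), div_mul_div_comm, mul_comm (Real.sqrt (Acoef n α α * _))]

/-- **Adding an index to `B`.** `B(α+e_j, β+e_j) = B(α,β)·(α_j+β_j+1)/((2α_j+1)(2β_j+1))^{1/2}`.
Consequently `B(α+e_j, β+e_j)` and `B(α,β)` have the same sign,
`|B(α+e_j, β+e_j)| ≥ |B(α,β)|`, and when `B(α,β) ≠ 0` equality holds iff `α_j = β_j`. -/
theorem Bcoef_add_single (n : ℕ) (hn : 1 ≤ n) (α β : Fin n → ℕ) (j : Fin n) :
    (Bcoef n (α + Pi.single j 1) (β + Pi.single j 1)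
        = Bcoef n α β * (((α j : ℝ) + (β j : ℝ) + 1) /
            Real.sqrt ((2 * (α j : ℝ) + 1) * (2 * (β j : ℝ) + 1))))
    ∧ (0 < Bcoef n α β ↔ 0 < Bcoef n (α + Pi.single j 1) (β + Pi.single j 1))
    ∧ (Bcoef n α β = 0 ↔ Bcoef n (α + Pi.single j 1) (β + Pi.single j 1) = 0)
    ∧ (Bcoef n α β < 0 ↔ Bcoef n (α + Pi.single j 1) (β + Pi.single j 1) < 0)
    ∧ |Bcoef n α β| ≤ |Bcoef n (α + Pi.single j 1) (β + Pi.single j 1)|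
    ∧ (Bcoef n α β ≠ 0 →
        (|Bcoef n (α + Pi.single j 1) (β + Pi.single j 1)| = |Bcoef n α β| ↔ α j = β j)) := by
  have hB := Bcoef_step n α β j
  set b := Bcoef n α β
  set c := ((α j : ℝ) + (β j : ℝ) + 1) /
            Real.sqrt ((2 * (α j : ℝ) + 1) * (2 * (β j : ℝ) + 1)) with hc
  have hP : (0 : ℝ) < (2 * (α j : ℝ) + 1) * (2 * (β j : ℝ) + 1) := by positivity
  have hS := Real.sqrt_pos.2 hP
  have hc0 : 0 < c := by positivity
  have hc1 : 1 ≤ c := by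
    rw [hc, one_le_div hS]
    refine Real.sqrt_le_iff.2 ⟨by positivity, ?_⟩
    nlinarith [sq_nonneg ((α j : ℝ) - β j)]
  have hce : c = 1 ↔ α j = β j := by
    rw [hc, div_eq_one_iff_eq hS.ne', eq_comm, Real.sqrt_eq_iff_mul_self_eq hP.le (by positivity)]
    constructor
    · intro h
      have h2 : ((α j : ℝ) - β j) ^ 2 = 0 := by nlinarith
      have h3 : (α j : ℝ) = β j := sub_eq_zero.1 (pow_eq_zero_iff (two_ne_zero) |>.1 h2)
      exact_mod_cast h3
    · intro h
      rw [h]; ring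
  rw [hB, abs_mul, abs_of_pos hc0]
  refine ⟨rfl, (mul_pos_iff_of_pos_right hc0).symm, ?_, ?_, ?_, ?_⟩
  · simp [hc0.ne']
  · constructor <;> intro h <;> nlinarith
  · exact le_mul_of_one_le_right (abs_nonneg _) hc1
  · intro hb
    rw [← hce, mul_eq_left₀ (abs_ne_zero.2 hb)]
end

section
/- For all multi-indices α, β ∈ ℕⁿ and every index j, the sequence k ↦ B(α, β + k·e_j) converges to 0 as k → ∞. -/
open Finset

lemma fact_aux (s : ℕ) : (2 * s).factorial ≤ 4 ^ s * (s.factorial * s.factorial) := by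
  induction s with
  | zero => simp
  | succ s ih =>
    have h : 2 * (s + 1) = 2 * s + 1 + 1 := by ring
    rw [h, Nat.factorial_succ, Nat.factorial_succ, Nat.factorial_succ]
    calc (2 * s + 1 + 1) * ((2 * s + 1) * (2 * s).factorial)
        ≤ (2 * s + 1 + 1) * ((2 * s + 1 + 1) * (4 ^ s * (s.factorial * s.factorial))) := by
          gcongr; omega
      _ = _ := by ring

/-- bounding ratio -/
noncomputable def FF (a m : ℕ) : ℝ :=
  ((a + m).factorial : ℝ) / (((m + m).factorial : ℝ) / (2 ^ m * (m.factorial : ℝ)))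

lemma FF_pos (a m : ℕ) : 0 < FF a m := by unfold FF; positivity

lemma FF_tendsto (a : ℕ) : Filter.Tendsto (FF a) Filter.atTop (nhds 0) := by
  apply Summable.tendsto_atTop_zero
  apply summable_of_ratio_test_tendsto_lt_one (l := 1 / 2) (by norm_num)
  · exact Filter.Eventually.of_forall fun m => (FF_pos a m).ne'
  · have h : ∀ m : ℕ, ‖FF a (m + 1)‖ / ‖FF a m‖
        = 1 / 2 + ((a : ℝ) + 1 / 2) / 2 * (1 / ((m : ℝ) + 1 / 2)) := by
      intro m
      rw [Real.norm_of_nonneg (FF_pos _ _).le, Real.norm_of_nonneg (FF_pos _ _).le]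
      unfold FF
      have h1 : m + 1 + (m + 1) = m + m + 1 + 1 := by ring
      rw [h1, ← add_assoc, Nat.factorial_succ, Nat.factorial_succ, Nat.factorial_succ,
        Nat.factorial_succ]
      push_cast
      have p1 : ((a + m).factorial : ℝ) ≠ 0 := by positivity
      have p2 : ((m + m).factorial : ℝ) ≠ 0 := by positivity
      have p3 : (m.factorial : ℝ) ≠ 0 := by positivity
      have p4 : (m : ℝ) + 1 / 2 ≠ 0 := by positivity
      have p5 : (m : ℝ) + m + 1 ≠ 0 := by positivity
      have p6 : (m : ℝ) + m + 1 + 1 ≠ 0 := by positivity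
      have p7 : (m : ℝ) * 2 + 1 ≠ 0 := by positivity
      field_simp
      ring
    simp_rw [h]
    have h2 : Filter.Tendsto (fun m : ℕ => 1 / ((m : ℝ) + 1 / 2)) Filter.atTop (nhds 0) := by
      simp_rw [one_div ((_ : ℝ) + _)]
      exact (Filter.tendsto_atTop_add_const_right _ _ tendsto_natCast_atTop_atTop).inv_tendsto_atTop
    have h3 := (h2.const_mul (((a : ℝ) + 1 / 2) / 2)).const_add (1 / 2)
    rw [mul_zero, add_zero] at h3
    exact h3

lemma Acoef_self (n : ℕ) (γ : Fin n → ℕ) :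
    Acoef n γ γ = ∏ i, (((γ i + γ i).factorial : ℝ) / (2 ^ (γ i) * ((γ i).factorial : ℝ))) := by
  unfold Acoef
  rw [if_pos (fun i => ⟨γ i, rfl⟩)]
  have h : ∀ i, (γ i + γ i) / 2 = γ i := fun i => by omega
  simp [h]

lemma Acoef_abs_le (n : ℕ) (α γ : Fin n → ℕ) :
    |Acoef n α γ| ≤ ∏ i, Real.sqrt ((α i + γ i).factorial : ℝ) := by
  unfold Acoef
  split_ifs with h
  · rw [abs_mul, abs_zpow, abs_neg, abs_one, one_zpow, one_mul, Finset.abs_prod]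
    refine Finset.prod_le_prod (fun _ _ => abs_nonneg _) fun i _ => ?_
    rw [abs_of_nonneg (by positivity)]
    apply Real.le_sqrt_of_sq_le
    obtain ⟨s, hs⟩ := h i
    have hs2 : (α i + γ i) / 2 = s := by omega
    rw [hs2, hs, div_pow, div_le_iff₀ (by positivity)]
    have h4 : ((s + s).factorial : ℝ) ≤ 4 ^ s * (s.factorial * s.factorial) := by
      have := fact_aux s
      rw [two_mul] at this
      exact_mod_cast this
    have h5 : (4 : ℝ) ^ s = 2 ^ s * 2 ^ s := by rw [← mul_pow]; norm_num
    rw [sq]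
    apply mul_le_mul_of_nonneg_left _ (by positivity)
    rw [h5] at h4
    linarith
  · simp only [abs_zero]
    positivity

/-- **Decay of `B` under one-sided repeated differentials.** As `k → ∞`,
`B(α, β + k·e_j)` converges to `0`. -/
theorem Bcoef_tendsto_add_one_side (n : ℕ) (hn : 1 ≤ n) (α β : Fin n → ℕ) (j : Fin n) :
    Filter.Tendsto (fun k : ℕ => Bcoef n α (β + Pi.single j k))
      Filter.atTop (nhds 0) := by
  have hb : ∀ k : ℕ, ‖Bcoef n α (β + Pi.single j k)‖ ≤
      (∏ i, Real.sqrt (FF (α i) ((β + Pi.single j k : Fin n → ℕ) i))) / Real.sqrt (Acoef n α α) := by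
    intro k
    generalize β + Pi.single j k = γ
    have hα : 0 ≤ Acoef n α α := by rw [Acoef_self]; positivity
    unfold Bcoef
    rw [Real.norm_eq_abs, abs_div, abs_of_nonneg (Real.sqrt_nonneg _), Real.sqrt_mul hα,
      mul_comm, ← div_div]
    apply div_le_div_of_nonneg_right _ (Real.sqrt_nonneg _)
    have h1 : ∏ i, Real.sqrt (FF (α i) (γ i)) =
        (∏ i, Real.sqrt ((α i + γ i).factorial : ℝ)) / Real.sqrt (Acoef n γ γ) := by
      rw [Acoef_self, Real.sqrt_prod _ (fun _ _ => by positivity), ← Finset.prod_div_distrib]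
      refine Finset.prod_congr rfl fun i _ => ?_
      unfold FF
      rw [Real.sqrt_div (by positivity)]
    rw [h1]
    exact div_le_div_of_nonneg_right (Acoef_abs_le _ _ _) (Real.sqrt_nonneg _)
  refine squeeze_zero_norm hb ?_
  have hp : Filter.Tendsto
      (fun k : ℕ => ∏ i, Real.sqrt (FF (α i) ((β + Pi.single j k : Fin n → ℕ) i))) Filter.atTop
      (nhds (∏ i, if i = j then 0 else Real.sqrt (FF (α i) (β i)))) := by
    refine tendsto_finsetProd _ fun i _ => ?_
    by_cases hij : i = j
    · subst hij
      simp only [Pi.add_apply, Pi.single_eq_same, if_true]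
      have h := (FF_tendsto (α i)).comp (Filter.tendsto_atTop_mono
        (fun k : ℕ => Nat.le_add_left k (β i)) Filter.tendsto_id)
      simpa using h.sqrt
    · simp [hij]
  have hz : (∏ i, if i = j then 0 else Real.sqrt (FF (α i) (β i))) = 0 :=
    Finset.prod_eq_zero (Finset.mem_univ j) (by simp)
  rw [hz] at hp
  simpa using hp.div_const (Real.sqrt (Acoef n α α))
end

section
/- For all multi-indices α, β ∈ ℕⁿ one has −1 < B(α,β) ≤ 1, and B(α,β) = 1 holds if and only if α = β. -/
open Finset

noncomputable def hterm (m : ℕ) : ℝ :=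
  (m.factorial : ℝ) / (2 ^ (m / 2) * ((m / 2).factorial : ℝ))

lemma hterm_pos (m : ℕ) : 0 < hterm m := by
  unfold hterm; positivity

lemma hterm_succ (s : ℕ) : hterm (2 * (s + 1)) = (2 * s + 1) * hterm (2 * s) := by
  unfold hterm
  have h1 : 2 * (s + 1) / 2 = s + 1 := by omega
  have h2 : 2 * s / 2 = s := by omega
  rw [h1, h2, show 2 * (s + 1) = (2 * s + 1) + 1 by ring, Nat.factorial_succ, Nat.factorial_succ,
    Nat.factorial_succ]
  push_cast
  field_simp
  ring

lemma hterm_lt_aux (p k : ℕ) :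
    hterm (2 * (p + (k + 1))) ^ 2 < hterm (2 * p) * hterm (2 * (p + 2 * (k + 1))) ∧
    hterm (2 * (p + k)) ^ 2 ≤ hterm (2 * p) * hterm (2 * (p + 2 * k)) := by
  have key : ∀ k : ℕ, hterm (2 * (p + k)) ^ 2 ≤ hterm (2 * p) * hterm (2 * (p + 2 * k)) →
      hterm (2 * (p + (k + 1))) ^ 2 < hterm (2 * p) * hterm (2 * (p + 2 * (k + 1))) := by
    intro k hk
    rw [show p + (k + 1) = (p + k) + 1 by ring, show p + 2 * (k + 1) = ((p + 2 * k) + 1) + 1 by ring,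
      hterm_succ, hterm_succ, hterm_succ]
    have hp := mul_pos (hterm_pos (2 * p)) (hterm_pos (2 * (p + 2 * k)))
    push_cast
    calc _ = (2 * ((p : ℝ) + k) + 1) ^ 2 * hterm (2 * (p + k)) ^ 2 := by ring
      _ ≤ (2 * ((p : ℝ) + k) + 1) ^ 2 * (hterm (2 * p) * hterm (2 * (p + 2 * k))) := by gcongr
      _ < ((2 * ((p : ℝ) + 2 * k + 1) + 1) * (2 * (p + 2 * k) + 1)) *
          (hterm (2 * p) * hterm (2 * (p + 2 * k))) := by
        apply mul_lt_mul_of_pos_right _ hp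
        have h1 : (0 : ℝ) ≤ p := p.cast_nonneg
        have h2 : (0 : ℝ) ≤ k := k.cast_nonneg
        nlinarith [mul_nonneg h1 h2, mul_nonneg h2 h2]
      _ = _ := by ring
  have le : ∀ k : ℕ, hterm (2 * (p + k)) ^ 2 ≤ hterm (2 * p) * hterm (2 * (p + 2 * k)) := by
    intro k
    induction k with
    | zero => simp [sq]
    | succ k ih => exact (key k ih).le
  exact ⟨key k (le k), le k⟩

lemma hterm_lt {a b : ℕ} (he : Even (a + b)) (hab : a ≠ b) :
    hterm (a + b) ^ 2 < hterm (a + a) * hterm (b + b) := by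
  wlog h : a < b generalizing a b
  · have := this (a := b) (b := a) (by rwa [add_comm]) hab.symm (by omega)
    rwa [add_comm, mul_comm]
  obtain ⟨k, rfl⟩ : ∃ k, b = a + 2 * (k + 1) := by
    obtain ⟨r, hr⟩ := he
    exact ⟨r - a - 1, by omega⟩
  have := (hterm_lt_aux a k).1
  rw [show a + (a + 2 * (k + 1)) = 2 * (a + (k + 1)) by ring, ← two_mul, ← two_mul]
  exact this

lemma hterm_le {a b : ℕ} (he : Even (a + b)) :
    hterm (a + b) ^ 2 ≤ hterm (a + a) * hterm (b + b) := by
  by_cases h : a = b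
  · subst h; rw [sq]
  · exact (hterm_lt he h).le

lemma Acoef_self_s11 (n : ℕ) (α : Fin n → ℕ) : Acoef n α α = ∏ j, hterm (α j + α j) := by
  unfold Acoef hterm
  simp

lemma Acoef_self_pos (n : ℕ) (α : Fin n → ℕ) : 0 < Acoef n α α := by
  rw [Acoef_self_s11]; exact Finset.prod_pos fun _ _ => hterm_pos _

lemma Acoef_sq_lt (n : ℕ) (α β : Fin n → ℕ) (h : α ≠ β) :
    Acoef n α β ^ 2 < Acoef n α α * Acoef n β β := by
  by_cases he : ∀ j, Even (α j + β j)
  · have h1 : Acoef n α β ^ 2 = ∏ j, hterm (α j + β j) ^ 2 := by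
      rw [← sq_abs]
      unfold Acoef
      rw [if_pos he, abs_mul, abs_zpow, abs_neg, abs_one, one_zpow, one_mul, sq_abs,
        ← Finset.prod_pow]
      rfl
    rw [h1, Acoef_self_s11, Acoef_self_s11, ← Finset.prod_mul_distrib]
    obtain ⟨j, hj⟩ := Function.ne_iff.mp h
    exact Finset.prod_lt_prod (fun i _ => pow_pos (hterm_pos _) 2) (fun i _ => hterm_le (he i))
      ⟨j, Finset.mem_univ j, hterm_lt (he j) hj⟩
  · have : Acoef n α β = 0 := by unfold Acoef; rw [if_neg he]
    rw [this]
    simpa using mul_pos (Acoef_self_pos n α) (Acoef_self_pos n β)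

theorem Bcoef_range (n : ℕ) (hn : 1 ≤ n) (α β : Fin n → ℕ) :
    (-1 < Bcoef n α β ∧ Bcoef n α β ≤ 1) ∧ (Bcoef n α β = 1 ↔ α = β) := by
  by_cases h : α = β
  · subst h
    have : Bcoef n α α = 1 := by
      unfold Bcoef
      have hp := Acoef_self_pos n α
      rw [Real.sqrt_mul_self hp.le, div_self hp.ne']
    rw [this]; norm_num
  · have hlt : |Bcoef n α β| < 1 := by
      have hp := mul_pos (Acoef_self_pos n α) (Acoef_self_pos n β)
      unfold Bcoef
      rw [abs_div, abs_of_pos (Real.sqrt_pos.mpr hp), div_lt_one (Real.sqrt_pos.mpr hp)]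
      apply Real.lt_sqrt_of_sq_lt
      rw [sq_abs]
      exact Acoef_sq_lt n α β h
    obtain ⟨h1, h2⟩ := abs_lt.mp hlt
    exact ⟨⟨h1, h2.le⟩, fun e => absurd e h2.ne, fun e => absurd e h⟩
end

section
/- The angle distance d(α,β) = arccos(B(α,β)) is a metric on the lattice ℕⁿ: d(α,β) ≥ 0 with d(α,β) = 0 if and only if α = β, d(α,β) = d(β,α), and d(α,γ) ≤ d(α,β) + d(β,γ) for all α, β, γ ∈ ℕⁿ. Moreover 0 ≤ d(α,β) < π for all α, β. -/
open Finset

/-- Coefficients of monomials in the Hermite basis. -/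
def hC : ℕ → ℕ → ℝ
  | 0, 0 => 1
  | 0, _ + 1 => 0
  | a + 1, 0 => hC a 1
  | a + 1, k + 1 => hC a k + ((k : ℝ) + 2) * hC a (k + 2)

lemma hC_succ_zero (a : ℕ) : hC (a+1) 0 = hC a 1 := by simp [hC]
lemma hC_succ_succ (a k : ℕ) :
    hC (a+1) (k+1) = hC a k + ((k : ℝ) + 2) * hC a (k + 2) := by simp [hC]

lemma hC_zero_of_lt : ∀ (a k : ℕ), a < k → hC a k = 0 := by
  intro a
  induction a with
  | zero => intro k hk; obtain ⟨k, rfl⟩ : ∃ m, k = m + 1 := ⟨k - 1, by omega⟩; simp [hC]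
  | succ a ih =>
    intro k hk
    obtain ⟨k, rfl⟩ : ∃ m, k = m + 1 := ⟨k - 1, by omega⟩
    rw [hC_succ_succ, ih k (by omega), ih (k+2) (by omega)]; simp

lemma hC_self : ∀ a : ℕ, hC a a = 1 := by
  intro a
  induction a with
  | zero => simp [hC]
  | succ a ih => rw [hC_succ_succ, ih, hC_zero_of_lt a (a+2) (by omega)]; simp

lemma hC_deriv : ∀ (a k : ℕ), ((k : ℝ) + 1) * hC (a+1) (k+1) = ((a : ℝ) + 1) * hC a k := by
  intro a
  induction a with
  | zero =>
    intro k
    cases k <;> simp [hC]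
  | succ a ih =>
    intro k
    cases k with
    | zero =>
      have h1 := ih 1
      rw [hC_succ_succ (a+1) 0, hC_succ_zero a]
      push_cast at *
      norm_num at *
      linarith
    | succ k =>
      have h1 := ih k
      have h2 := ih (k+2)
      rw [hC_succ_succ (a+1) (k+1), hC_succ_succ a k]
      have h3 := hC_succ_succ a k
      push_cast at *
      rw [h3] at h1
      linear_combination h1 + ((k:ℝ)+2) * h2

lemma hC_two (a : ℕ) : hC (a+2) 0 = ((a:ℝ)+1) * hC a 0 := by
  have := hC_deriv a 0
  rw [hC_succ_zero]; simpa using this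

lemma hC_moment (a : ℕ) : hC a 0 = if Even a then
    (a.factorial : ℝ) / (2 ^ (a/2) * ((a/2).factorial : ℝ)) else 0 := by
  induction a using Nat.twoStepInduction with
  | zero => simp [hC]
  | one => simp [hC]
  | more a ih _ =>
    rw [hC_two, ih]
    by_cases h : Even a
    · have h' : Even (a+2) := by grind
      rw [if_pos h, if_pos h']
      obtain ⟨m, rfl⟩ := h
      have e1 : (m + m)/2 = m := by omega
      have e2 : (m + m + 2)/2 = m + 1 := by omega
      rw [e1, e2]
      simp only [Nat.factorial_succ, pow_succ]
      have : (m.factorial : ℝ) ≠ 0 := by positivity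
      push_cast
      field_simp
      ring
    · have h' : ¬ Even (a+2) := by grind
      rw [if_neg h, if_neg h']; simp

lemma hC_shift_aux (a b N : ℕ) :
    ∑ k ∈ range (N+1), (k.factorial : ℝ) * hC (a+1) k * hC b k
     = ∑ k ∈ range (N+1), ((k+1).factorial : ℝ) * hC a (k+1) * hC b k
      + ∑ k ∈ range N, ((k+1).factorial : ℝ) * hC a k * hC b (k+1) := by
  rw [Finset.sum_range_succ', Finset.sum_range_succ' (fun k => ((k+1).factorial : ℝ) * hC a (k+1) * hC b k)]
  rw [add_right_comm, ← Finset.sum_add_distrib]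
  congr 1
  · apply Finset.sum_congr rfl
    intro k _
    rw [hC_succ_succ, Nat.factorial_succ (k+1)]
    push_cast
    ring

lemma hC_shift (a b N : ℕ) (ha : a < N + 1) (hb : b < N + 1) :
    ∑ k ∈ range (N+1), (k.factorial : ℝ) * hC (a+1) k * hC b k
     = ∑ k ∈ range (N+1), (k.factorial : ℝ) * hC a k * hC (b+1) k := by
  have h2 := hC_shift_aux b a N
  rw [hC_shift_aux a b N, Finset.sum_range_succ, hC_zero_of_lt a (N+1) ha]
  rw [Finset.sum_range_succ (fun k => ((k+1).factorial : ℝ) * hC b (k+1) * hC a k), hC_zero_of_lt b (N+1) hb] at h2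
  have e : ∑ k ∈ range (N+1), (k.factorial : ℝ) * hC a k * hC (b+1) k
      = ∑ k ∈ range (N+1), (k.factorial : ℝ) * hC (b+1) k * hC a k :=
    Finset.sum_congr rfl fun k _ => by ring
  rw [e, h2]
  simp only [mul_zero, zero_mul, add_zero]
  rw [add_comm]
  congr 1 <;> exact Finset.sum_congr rfl fun k _ => by ring

lemma hC_inner_big : ∀ (a b N : ℕ), a + b < N + 1 →
    ∑ k ∈ range (N+1), (k.factorial : ℝ) * hC a k * hC b k = hC (a+b) 0 := by
  intro a
  induction a with
  | zero =>
    intro b N h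
    rw [Finset.sum_range_succ']
    simp [hC]
  | succ a ih =>
    intro b N h
    rw [hC_shift a b N (by omega) (by omega), ih (b+1) N (by omega)]
    congr 1; omega

/-- One-dimensional vectors. -/
noncomputable def hw (a k : ℕ) : ℝ := (-1) ^ (a/2) * Real.sqrt (k.factorial) * hC a k

lemma hw_inner (a b N : ℕ) (h : a + b < N + 1) :
    ∑ k : Fin (N+1), hw a k * hw b k = if Even (a+b) then
      (-1:ℝ)^(a/2+b/2) * (((a+b).factorial : ℝ) / (2 ^ ((a+b)/2) * (((a+b)/2).factorial : ℝ)))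
      else 0 := by
  rw [Fin.sum_univ_eq_sum_range (fun k => hw a k * hw b k) (N+1)]
  have : ∑ k ∈ range (N+1), hw a k * hw b k = (-1:ℝ)^(a/2+b/2) * hC (a+b) 0 := by
    rw [← hC_inner_big a b N h, Finset.mul_sum]
    apply Finset.sum_congr rfl
    intro k _
    have hs : Real.sqrt (k.factorial : ℝ) * Real.sqrt (k.factorial : ℝ) = k.factorial :=
      Real.mul_self_sqrt (by positivity)
    unfold hw
    rw [pow_add]
    linear_combination ((-1:ℝ)^(a/2) * (-1:ℝ)^(b/2) * hC a k * hC b k) * hs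
  rw [this, hC_moment]
  split_ifs <;> simp

/-- The vector attached to a multi-index. -/
noncomputable def hV (n N : ℕ) (α : Fin n → ℕ) : EuclideanSpace ℝ (Fin n → Fin (N+1)) :=
  WithLp.toLp 2 fun κ => ∏ j, hw (α j) (κ j)

lemma sign_eq (n : ℕ) (α β : Fin n → ℕ) (h : ∀ j, Even (α j + β j)) :
    (-1 : ℝ) ^ (((∑ j, (α j : ℤ)) - ∑ j, (β j : ℤ)) / 2) = ∏ j, (-1:ℝ)^(α j/2 + β j/2) := by
  have e : ((∑ j, (α j : ℤ)) - ∑ j, (β j : ℤ)) / 2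
      = ((∑ j, (α j/2 + β j/2) : ℕ) : ℤ) - 2 * ((∑ j, (β j/2) : ℕ) : ℤ) := by
    have : (∑ j, (α j : ℤ)) - ∑ j, (β j : ℤ)
      = 2 * (((∑ j, (α j/2 + β j/2) : ℕ) : ℤ) - 2 * ((∑ j, (β j/2) : ℕ) : ℤ)) := by
      rw [← Finset.sum_sub_distrib, Nat.cast_sum, Nat.cast_sum, Finset.mul_sum,
        ← Finset.sum_sub_distrib, Finset.mul_sum]
      apply Finset.sum_congr rfl
      intro j _
      have := h j
      rw [Nat.even_iff] at this
      omega
    omega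
  rw [e, zpow_sub₀ (by norm_num), zpow_mul, zpow_natCast, Finset.prod_pow_eq_pow_sum]
  norm_num

lemma hV_inner (n N : ℕ) (α β : Fin n → ℕ) (h : ∀ j, α j + β j < N + 1) :
    inner ℝ (hV n N α) (hV n N β) = Acoef n α β := by
  have e : inner ℝ (hV n N α) (hV n N β) = ∏ j, ∑ k : Fin (N+1), hw (α j) k * hw (β j) k := by
    rw [Finset.prod_univ_sum, PiLp.inner_apply]
    simp only [hV, Fintype.piFinset_univ, Finset.prod_mul_distrib]
    apply Finset.sum_congr rfl
    intro κ _
    simp [mul_comm]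
  rw [e]
  unfold Acoef
  split_ifs with hE
  · rw [sign_eq n α β hE, ← Finset.prod_mul_distrib]
    apply Finset.prod_congr rfl
    intro j _
    rw [hw_inner _ _ _ (h j), if_pos (hE j)]
  · push Not at hE
    obtain ⟨j, hj⟩ := hE
    apply Finset.prod_eq_zero (Finset.mem_univ j)
    rw [hw_inner _ _ _ (h j), if_neg (by simpa using hj)]

lemma dAngle_eq (n N : ℕ) (α β : Fin n → ℕ) (ha : ∀ j, α j + α j < N + 1)
    (hb : ∀ j, β j + β j < N + 1) :
    dAngle n α β = InnerProductGeometry.angle (hV n N α) (hV n N β) := by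
  unfold dAngle InnerProductGeometry.angle Bcoef
  rw [← hV_inner n N α β (fun j => by have := ha j; have := hb j; omega),
    ← hV_inner n N α α ha, ← hV_inner n N β β hb,
    real_inner_self_eq_norm_sq, real_inner_self_eq_norm_sq, ← mul_pow,
    Real.sqrt_sq (by positivity)]

lemma hV_apply (n N : ℕ) (α : Fin n → ℕ) (κ : Fin n → Fin (N+1)) :
    hV n N α κ = ∏ j, hw (α j) (κ j) := rfl

lemma hV_self_ne (n N : ℕ) (α : Fin n → ℕ) (ha : ∀ j, α j < N + 1) :
    hV n N α (fun j => ⟨α j, ha j⟩) ≠ 0 := by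
  rw [hV_apply, Finset.prod_ne_zero_iff]
  intro j _
  have : Real.sqrt ((α j).factorial : ℝ) ≠ 0 := by positivity
  simp [hw, hC_self, this]

lemma le_of_hV (n N : ℕ) (α β : Fin n → ℕ) (ha : ∀ j, α j < N + 1)
    (h : hV n N β (fun j => ⟨α j, ha j⟩) ≠ 0) : ∀ j, α j ≤ β j := by
  intro j
  rw [hV_apply, Finset.prod_ne_zero_iff] at h
  by_contra hlt
  apply h j (Finset.mem_univ j)
  simp [hw, hC_zero_of_lt _ _ (not_le.mp hlt)]

lemma eq_of_smul (n N : ℕ) (α β : Fin n → ℕ) (ha : ∀ j, α j < N + 1) (hb : ∀ j, β j < N + 1)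
    (r : ℝ) (hr : r ≠ 0) (h : hV n N β = r • hV n N α) : α = β := by
  funext j
  apply le_antisymm
  · apply le_of_hV n N α β ha
    rw [h]
    simpa [hr] using hV_self_ne n N α ha
  · apply le_of_hV n N β α hb
    have := hV_self_ne n N β hb
    rw [h] at this
    simp only [PiLp.smul_apply, smul_eq_mul] at this
    exact right_ne_zero_of_mul this

lemma hV_ne (n N : ℕ) (α : Fin n → ℕ) (ha : ∀ j, α j < N + 1) : hV n N α ≠ 0 := by
  intro h
  apply hV_self_ne n N α ha
  rw [h]; rfl

lemma exists_bound (n : ℕ) (α β γ : Fin n → ℕ) : ∃ N, (∀ j, α j + α j < N + 1) ∧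
    (∀ j, β j + β j < N + 1) ∧ (∀ j, γ j + γ j < N + 1) := by
  refine ⟨2 * ∑ j, (α j + β j + γ j), ?_, ?_, ?_⟩ <;> intro j <;>
  · have := Finset.single_le_sum (f := fun j => α j + β j + γ j) (fun i _ => Nat.zero_le _)
      (Finset.mem_univ j)
    omega

/-- **The angle distance is a metric on `ℕⁿ`.** `d` is nonnegative, vanishes exactly on the
diagonal, is symmetric, satisfies the triangle inequality, and takes values in `[0, π)`. -/
theorem dAngle_is_metric (n : ℕ) (hn : 1 ≤ n) :
    (∀ α β : Fin n → ℕ, 0 ≤ dAngle n α β)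
    ∧ (∀ α β : Fin n → ℕ, dAngle n α β = 0 ↔ α = β)
    ∧ (∀ α β : Fin n → ℕ, dAngle n α β = dAngle n β α)
    ∧ (∀ α β γ : Fin n → ℕ, dAngle n α γ ≤ dAngle n α β + dAngle n β γ)
    ∧ (∀ α β : Fin n → ℕ, dAngle n α β < Real.pi) := by
  refine ⟨fun α β => Real.arccos_nonneg _, fun α β => ?_, fun α β => ?_, fun α β γ => ?_,
    fun α β => ?_⟩
  · obtain ⟨N, h1, h2, -⟩ := exists_bound n α β β
    have h1' : ∀ j, α j < N + 1 := fun j => by have := h1 j; omega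
    have h2' : ∀ j, β j < N + 1 := fun j => by have := h2 j; omega
    rw [dAngle_eq n N α β h1 h2]
    constructor
    · intro h
      obtain ⟨-, r, hr, h⟩ := InnerProductGeometry.angle_eq_zero_iff.mp h
      exact eq_of_smul n N α β h1' h2' r hr.ne' h
    · rintro rfl
      exact InnerProductGeometry.angle_self (hV_ne n N α h1')
  · obtain ⟨N, h1, h2, -⟩ := exists_bound n α β β
    rw [dAngle_eq n N α β h1 h2, dAngle_eq n N β α h2 h1, InnerProductGeometry.angle_comm]
  · obtain ⟨N, h1, h2, h3⟩ := exists_bound n α β γ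
    rw [dAngle_eq n N α β h1 h2, dAngle_eq n N α γ h1 h3, dAngle_eq n N β γ h2 h3]
    exact InnerProductGeometry.angle_le_angle_add_angle _ _ _
  · obtain ⟨N, h1, h2, -⟩ := exists_bound n α β β
    have h1' : ∀ j, α j < N + 1 := fun j => by have := h1 j; omega
    have h2' : ∀ j, β j < N + 1 := fun j => by have := h2 j; omega
    rw [dAngle_eq n N α β h1 h2]
    refine lt_of_le_of_ne (InnerProductGeometry.angle_le_pi _ _) fun h => ?_
    have h0 := h
    obtain ⟨-, r, hr, h⟩ := InnerProductGeometry.angle_eq_pi_iff.mp h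
    have := eq_of_smul n N α β h1' h2' r hr.ne h
    subst this
    rw [InnerProductGeometry.angle_self (hV_ne n N α h1')] at h0
    exact Real.pi_pos.ne h0
end

section
/- For all multi-indices α, β ∈ ℕⁿ and every index j, the angle distance satisfies |d(α + e_j, β + e_j) − π/2| ≥ |d(α,β) − π/2|. -/
open Finset

theorem Acoef_succ (n : ℕ) (α β : Fin n → ℕ) (j : Fin n) :
    Acoef n (α + Pi.single j 1) (β + Pi.single j 1)
      = ((α j : ℝ) + β j + 1) * Acoef n α β := by
  have hne : ∀ i, i ≠ j → (α + Pi.single j 1 : Fin n → ℕ) i = α i ∧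
      (β + Pi.single j 1 : Fin n → ℕ) i = β i := by
    intro i hi
    simp [hi]
  have hj : (α + Pi.single j 1 : Fin n → ℕ) j = α j + 1 ∧
      (β + Pi.single j 1 : Fin n → ℕ) j = β j + 1 := by
    simp
  have hev : (∀ i, Even ((α + Pi.single j 1 : Fin n → ℕ) i + (β + Pi.single j 1 : Fin n → ℕ) i))
      ↔ ∀ i, Even (α i + β i) := by
    refine forall_congr' fun i => ?_
    by_cases hi : i = j
    · subst hi
      rw [hj.1, hj.2]
      grind
    · rw [(hne i hi).1, (hne i hi).2]
  unfold Acoef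
  by_cases h : ∀ i, Even (α i + β i)
  · rw [if_pos h, if_pos (hev.2 h)]
    have hs : ((∑ i, ((α + Pi.single j 1 : Fin n → ℕ) i : ℤ))
        - ∑ i, ((β + Pi.single j 1 : Fin n → ℕ) i : ℤ))
        = (∑ i, (α i : ℤ)) - ∑ i, (β i : ℤ) := by
      simp only [Pi.add_apply, Nat.cast_add, Finset.sum_add_distrib]
      ring
    rw [hs, ← Finset.mul_prod_erase _ _ (Finset.mem_univ j),
      ← Finset.mul_prod_erase (a := j) Finset.univ (fun i => ((α i + β i).factorial : ℝ) /
        (2 ^ ((α i + β i) / 2) * (((α i + β i) / 2).factorial : ℝ))) (Finset.mem_univ j)]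
    have hp : ∀ i ∈ Finset.univ.erase j,
        ((((α + Pi.single j 1 : Fin n → ℕ) i + (β + Pi.single j 1 : Fin n → ℕ) i).factorial : ℝ) /
        (2 ^ (((α + Pi.single j 1 : Fin n → ℕ) i + (β + Pi.single j 1 : Fin n → ℕ) i) / 2) *
         ((((α + Pi.single j 1 : Fin n → ℕ) i + (β + Pi.single j 1 : Fin n → ℕ) i) / 2).factorial : ℝ)))
        = ((α i + β i).factorial : ℝ) /
        (2 ^ ((α i + β i) / 2) * (((α i + β i) / 2).factorial : ℝ)) := by
      intro i hi
      have := hne i (Finset.ne_of_mem_erase hi)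
      rw [this.1, this.2]
    rw [Finset.prod_congr rfl hp, hj.1, hj.2]
    obtain ⟨s, hs2⟩ := h j
    have e1 : α j + 1 + (β j + 1) = 2 * s + 1 + 1 := by omega
    have e2 : α j + β j = 2 * s := by omega
    have e3 : (α j : ℝ) + β j = 2 * s := by exact_mod_cast e2
    have e4 : (2 * s + 1 + 1) / 2 = s + 1 := by omega
    have e5 : (2 * s) / 2 = s := by omega
    rw [e1, e2, e3, e4, e5, Nat.factorial_succ, Nat.factorial_succ (2 * s), Nat.factorial_succ s]
    have hf : (s.factorial : ℝ) ≠ 0 := by positivity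
    have key : (((2 * s + 1 + 1) * ((2 * s + 1) * (2 * s).factorial) : ℕ) : ℝ) /
        (2 ^ (s + 1) * (((s + 1) * s.factorial : ℕ) : ℝ))
        = (2 * (s : ℝ) + 1) * (((2 * s).factorial : ℝ) / (2 ^ s * (s.factorial : ℝ))) := by
      have h1 : (s : ℝ) + 1 ≠ 0 := by positivity
      push_cast
      field_simp
      ring
    rw [key]
    ring
  · rw [if_neg h, if_neg (fun h' => h (hev.1 h')), mul_zero]

theorem Bcoef_succ (n : ℕ) (α β : Fin n → ℕ) (j : Fin n) :
    ∃ c : ℝ, 1 ≤ c ∧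
      Bcoef n (α + Pi.single j 1) (β + Pi.single j 1) = c * Bcoef n α β := by
  have ha : (0 : ℝ) ≤ α j := by positivity
  have hb : (0 : ℝ) ≤ β j := by positivity
  refine ⟨((α j : ℝ) + β j + 1) /
    Real.sqrt (((α j : ℝ) + α j + 1) * ((β j : ℝ) + β j + 1)), ?_, ?_⟩
  · rw [le_div_iff₀ (Real.sqrt_pos.2 (by positivity)), one_mul]
    apply Real.sqrt_le_iff.2
    constructor
    · positivity
    · nlinarith [sq_nonneg ((α j : ℝ) - β j)]
  · unfold Bcoef
    rw [Acoef_succ, Acoef_succ, Acoef_succ, mul_mul_mul_comm,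
      Real.sqrt_mul (by positivity), mul_div_mul_comm]

theorem abs_arcsin_eq (x : ℝ) : |Real.arcsin x| = Real.arcsin |x| := by
  rcases le_total 0 x with h | h
  · rw [abs_of_nonneg h, abs_of_nonneg (Real.arcsin_nonneg.2 h)]
  · rw [abs_of_nonpos h, abs_of_nonpos (Real.arcsin_nonpos.2 h), Real.arcsin_neg]

/-- **Stabilization inequality for the angle distance.**
`|d(α+e_j, β+e_j) − π/2| ≥ |d(α,β) − π/2|`. -/
theorem dAngle_add_single (n : ℕ) (hn : 1 ≤ n) (α β : Fin n → ℕ) (j : Fin n) :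
    |dAngle n α β - Real.pi / 2|
      ≤ |dAngle n (α + Pi.single j 1) (β + Pi.single j 1) - Real.pi / 2| := by
  obtain ⟨c, hc, hB⟩ := Bcoef_succ n α β j
  unfold dAngle
  have e : ∀ x : ℝ, |Real.arccos x - Real.pi / 2| = Real.arcsin |x| := by
    intro x
    rw [← abs_arcsin_eq, Real.arccos_eq_pi_div_two_sub_arcsin, sub_sub_cancel_left, abs_neg]
  rw [e, e, hB, abs_mul, abs_of_nonneg (by linarith : (0 : ℝ) ≤ c)]
  exact Real.monotone_arcsin (le_mul_of_one_le_left (abs_nonneg _) hc)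
end

section
/- There exists a constant δ > 0 such that for every s ≥ 1 and all natural numbers σ_1,…,σ_s and l_1,…,l_s with 0 ≤ l_r ≤ σ_r for each r and Σ_{r=1}^s σ_r ≥ 1, one has Π_{r=1}^{s} Π_{i=1}^{l_r} (2σ_r − 2i + 1)/(2σ_r + 2i − 1) ≤ 1 − δ · (Σ_{r=1}^s l_r)/(Σ_{r=1}^s σ_r). -/
open Finset

/-- **Uniform combinatorial inequality.** There is a constant `δ > 0` such that for every
`s ≥ 1` and all natural numbers `σ_1,…,σ_s`, `l_1,…,l_s` with `l_r ≤ σ_r` for each `r` and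
`Σ_r σ_r ≥ 1`, one has
`Π_r Π_{i=1}^{l_r} (2σ_r−2i+1)/(2σ_r+2i−1) ≤ 1 − δ·(Σ_r l_r)/(Σ_r σ_r)`. -/
theorem uniform_combinatorial_inequality :
    ∃ δ : ℝ, 0 < δ ∧ ∀ (s : ℕ), 1 ≤ s → ∀ σ l : Fin s → ℕ,
      (∀ r, l r ≤ σ r) → 1 ≤ ∑ r, σ r →
      (∏ r, ∏ i ∈ Finset.Icc 1 (l r),
          (2 * (σ r : ℝ) - 2 * (i : ℝ) + 1) / (2 * (σ r : ℝ) + 2 * (i : ℝ) - 1))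
        ≤ 1 - δ * (∑ r, (l r : ℝ)) / (∑ r, (σ r : ℝ)) := by
  refine ⟨1 / 4, by norm_num, ?_⟩
  intro s _ σ l hl hS
  have hS1 : (1 : ℝ) ≤ ∑ r, (σ r : ℝ) := by exact_mod_cast hS
  have hLS : (∑ r, (l r : ℝ)) ≤ ∑ r, (σ r : ℝ) :=
    Finset.sum_le_sum fun r _ => by exact_mod_cast hl r
  have hL0 : (0 : ℝ) ≤ ∑ r, (l r : ℝ) := Finset.sum_nonneg fun r _ => by positivity
  have hσS : ∀ r, (σ r : ℝ) ≤ ∑ r, (σ r : ℝ) := fun r =>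
    Finset.single_le_sum (f := fun r => (σ r : ℝ)) (fun r _ => by positivity) (Finset.mem_univ r)
  generalize (∑ r, (σ r : ℝ)) = S at *
  have hfac : ∀ r, ∀ i ∈ Finset.Icc 1 (l r),
      0 ≤ (2 * (σ r : ℝ) - 2 * (i : ℝ) + 1) / (2 * (σ r : ℝ) + 2 * (i : ℝ) - 1) ∧
      (2 * (σ r : ℝ) - 2 * (i : ℝ) + 1) / (2 * (σ r : ℝ) + 2 * (i : ℝ) - 1)
        ≤ Real.exp (-(1 / (2 * S))) := by
    intro r i hi
    rw [Finset.mem_Icc] at hi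
    have h1 : (1 : ℝ) ≤ i := by exact_mod_cast hi.1
    have h2 : (i : ℝ) ≤ σ r := by exact_mod_cast hi.2.trans (hl r)
    have h3 := hσS r
    refine ⟨div_nonneg (by linarith) (by linarith), ?_⟩
    have h4 := Real.add_one_le_exp (-(1 / (2 * S)))
    refine le_trans ?_ h4
    rw [div_le_iff₀ (by linarith)]
    have h5 : 1 / (2 * S) * (2 * (σ r : ℝ) + 2 * (i : ℝ) - 1) ≤ 4 * i - 2 := by
      rw [div_mul_eq_mul_div, div_le_iff₀ (by linarith)]
      nlinarith
    linarith
  have hprod : (∏ r, ∏ i ∈ Finset.Icc 1 (l r),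
          (2 * (σ r : ℝ) - 2 * (i : ℝ) + 1) / (2 * (σ r : ℝ) + 2 * (i : ℝ) - 1))
      ≤ ∏ r, ∏ i ∈ Finset.Icc 1 (l r), Real.exp (-(1 / (2 * S))) :=
    Finset.prod_le_prod (fun r _ => Finset.prod_nonneg fun i hi => (hfac r i hi).1)
      (fun r _ => Finset.prod_le_prod (fun i hi => (hfac r i hi).1) (fun i hi => (hfac r i hi).2))
  refine hprod.trans ?_
  have he : (∏ r, ∏ i ∈ Finset.Icc 1 (l r), Real.exp (-(1 / (2 * S))))
      = Real.exp (-((∑ r, (l r : ℝ)) / (2 * S))) := by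
    simp only [← Real.exp_sum, Finset.sum_const, Nat.card_Icc, Nat.add_sub_cancel, nsmul_eq_mul,
      ← Finset.sum_mul]
    congr 1
    ring
  rw [he]
  generalize (∑ r, (l r : ℝ)) = L at *
  have hx0 : 0 ≤ L / (2 * S) := div_nonneg hL0 (by linarith)
  have hx1 : L / (2 * S) ≤ 1 := by
    rw [div_le_iff₀ (by linarith)]; linarith
  have hr : 1 - 1 / 4 * L / S = 1 - (L / (2 * S)) / 2 := by
    field_simp
    ring
  rw [hr]
  generalize L / (2 * S) = x at *
  rw [Real.exp_neg]
  have h6 := Real.add_one_le_exp x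
  rw [inv_le_iff_one_le_mul₀ (Real.exp_pos x)]
  nlinarith
end

section
/- For all natural numbers σ ≥ 1 and 0 ≤ l ≤ σ, one has Π_{i=1}^{l} (2σ − 2i + 1)/(2σ + 2i − 1) ≤ ((2σ − l)/(2σ + l))^{l} ≤ 1 − l/(2σ). -/
open Finset

/-- **Single-index product estimate.** For `1 ≤ σ` and `l ≤ σ`,
`Π_{i=1}^{l} (2σ−2i+1)/(2σ+2i−1) ≤ ((2σ−l)/(2σ+l))^l ≤ 1 − l/(2σ)`. -/
theorem single_product_estimate (σ l : ℕ) (hσ : 1 ≤ σ) (hl : l ≤ σ) :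
    (∏ i ∈ Finset.Icc 1 l,
        (2 * (σ : ℝ) - 2 * (i : ℝ) + 1) / (2 * (σ : ℝ) + 2 * (i : ℝ) - 1))
      ≤ ((2 * (σ : ℝ) - (l : ℝ)) / (2 * (σ : ℝ) + (l : ℝ))) ^ l
    ∧ ((2 * (σ : ℝ) - (l : ℝ)) / (2 * (σ : ℝ) + (l : ℝ))) ^ l ≤ 1 - (l : ℝ) / (2 * (σ : ℝ)) := by
  have hs : (1 : ℝ) ≤ σ := by exact_mod_cast hσ
  have hls : (l : ℝ) ≤ σ := by exact_mod_cast hl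
  have hl0 : (0 : ℝ) ≤ l := Nat.cast_nonneg l
  have hx0 : 0 ≤ (2 * (σ : ℝ) - (l : ℝ)) / (2 * (σ : ℝ) + (l : ℝ)) :=
    div_nonneg (by linarith) (by linarith)
  constructor
  · have hIcc : (∏ i ∈ Finset.Icc 1 l,
        (2 * (σ : ℝ) - 2 * (i : ℝ) + 1) / (2 * (σ : ℝ) + 2 * (i : ℝ) - 1))
        = ∏ j ∈ Finset.range l,
          (2 * (σ : ℝ) - (2 * (j : ℝ) + 1)) / (2 * (σ : ℝ) + (2 * (j : ℝ) + 1)) := by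
      symm
      refine Finset.prod_bij (fun j _ => j + 1) ?_ ?_ ?_ ?_
      · intro j hj
        simp only [Finset.mem_range] at hj
        simp only [Finset.mem_Icc]
        omega
      · intro a _ b _ h
        simpa using h
      · intro b hb
        simp only [Finset.mem_Icc] at hb
        exact ⟨b - 1, by simp only [Finset.mem_range]; omega, by omega⟩
      · intro j _
        push_cast
        congr 1 <;> ring
    rw [hIcc]
    have hnn : ∀ j ∈ Finset.range l, (0 : ℝ) ≤
        (2 * (σ : ℝ) - (2 * (j : ℝ) + 1)) / (2 * (σ : ℝ) + (2 * (j : ℝ) + 1)) := by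
      intro j hj
      have : ((j : ℝ) + 1) ≤ l := by exact_mod_cast Finset.mem_range.mp hj
      exact div_nonneg (by linarith) (by positivity)
    refine (fun h1 h2 => abs_le_of_sq_le_sq' h1 h2 |>.2) ?_ (pow_nonneg hx0 l)
    rw [sq]
    nth_rewrite 2 [← Finset.prod_range_reflect]
    rw [← Finset.prod_mul_distrib, ← pow_mul, mul_comm l 2, pow_mul]
    have hc := Finset.prod_const (s := Finset.range l)
      (((2 * (σ : ℝ) - (l : ℝ)) / (2 * (σ : ℝ) + (l : ℝ))) ^ 2)
    rw [Finset.card_range] at hc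
    rw [← hc]
    refine Finset.prod_le_prod ?_ ?_
    · intro j hj
      refine mul_nonneg (hnn j hj) (hnn (l - 1 - j) ?_)
      simp only [Finset.mem_range] at hj ⊢
      omega
    · intro j hj
      have hj' := Finset.mem_range.mp hj
      have hjl : ((j : ℝ) + 1) ≤ l := by exact_mod_cast hj'
      have hj0 : (0 : ℝ) ≤ j := Nat.cast_nonneg j
      have e : ((l - 1 - j : ℕ) : ℝ) = l - 1 - j := by
        rw [Nat.sub_sub, Nat.cast_sub (by omega)]
        push_cast
        ring
      rw [e, div_mul_div_comm, div_pow, div_le_div_iff₀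
        (mul_pos (by linarith) (by linarith)) (by positivity)]
      have h := mul_nonneg (mul_nonneg (by linarith : (0 : ℝ) ≤ σ) hl0)
        (sq_nonneg ((l : ℝ) - (2 * j + 1)))
      nlinarith [h]
  · rcases Nat.eq_zero_or_pos l with h | h
    · subst h
      simp
    · have hx1 : (2 * (σ : ℝ) - (l : ℝ)) / (2 * (σ : ℝ) + (l : ℝ)) ≤ 1 := by
        rw [div_le_one (by linarith)]
        linarith
      calc _ ≤ (2 * (σ : ℝ) - (l : ℝ)) / (2 * (σ : ℝ) + (l : ℝ)) :=
            pow_le_of_le_one hx0 hx1 (by omega)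
        _ ≤ (2 * (σ : ℝ) - (l : ℝ)) / (2 * (σ : ℝ)) :=
            div_le_div_of_nonneg_left (by linarith) (by linarith) (by linarith)
        _ = _ := by
            have : (σ : ℝ) ≠ 0 := by linarith
            field_simp
end
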